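/- arXiv:1805.05876 — 4 statements merged into one kernel-verified Lean document; each statement's English description precedes it below -/
import Mathlib

section
/- Let g, P_f, P₁, V₁ ∈ ℝ³, δt ∈ ℝ, let R₁ be a rotation matrix, and let Γ₂, Γ₄ ∈ ℝ³ˣ³ be arbitrary. Define Γ₁ = ⌊(P_f − P₁ − V₁δt + ½δt²g)×⌋R₁ and the 3×18 block matrix M = [Γ₁, Γ₂, −δt·I₃, Γ₄, −I₃, I₃]. Let N ∈ ℝ¹⁸ˣ⁴ have first column (R₁ᵀg; 0; −⌊V₁×⌋g; 0; −⌊P₁×⌋g; −⌊P_f×⌋g) (six stacked 3-vectors) and remaining three columns given by the stacked 3×3 blocks (0; 0; 0; 0; I₃; I₃). Then M·N = 0. Hence every block row of the observability matrix of the linearized aided INS with a point feature annihilates the four directions corresponding to rotation about gravity (global yaw) and global translation of the sensor and feature. -/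
open Matrix

noncomputable section

abbrev V3 : Type := Fin 3 → ℝ
abbrev M3 : Type := Matrix (Fin 3) (Fin 3) ℝ

/-- The skew-symmetric cross-product matrix `⌊v×⌋`. -/
def skew (v : V3) : M3 :=
  !![0, -(v 2), v 1; v 2, 0, -(v 0); -(v 1), v 0, 0]

/-- `R` is a rotation matrix: `RᵀR = I₃` and `det R = 1`. -/
def IsRot (R : M3) : Prop := Rᵀ * R = 1 ∧ R.det = 1

/-- Euclidean norm on `ℝ³`. -/
def norm3 (v : V3) : ℝ := Real.sqrt (v ⬝ᵥ v)

def e1 : V3 := ![1, 0, 0]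
def e2 : V3 := ![0, 1, 0]
def e3 : V3 := ![0, 0, 1]

/-- The 3×3 matrix with the given columns. -/
def cols3 (a b c : V3) : M3 := Matrix.of fun i j => ![a i, b i, c i] j

/-- The 3×3 matrix with the given rows. -/
def rows3 (a b c : V3) : M3 := Matrix.of ![a, b, c]

/-- 18-dimensional aided-INS state index:
(orientation, gyro bias, velocity, accel bias, position, feature). -/
abbrev S18 : Type := Fin 3 ⊕ Fin 3 ⊕ Fin 3 ⊕ Fin 3 ⊕ Fin 3 ⊕ Fin 3

/-- The 3×18 block row `[A B C D E F]`. -/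
def row6 (A B C D E F : M3) : Matrix (Fin 3) S18 ℝ :=
  Matrix.of fun i =>
    Sum.elim (fun j => A i j) (Sum.elim (fun j => B i j) (Sum.elim (fun j => C i j)
      (Sum.elim (fun j => D i j) (Sum.elim (fun j => E i j) (fun j => F i j)))))

/-- The stacked vector `(a; b; c; d; e; f)` in ℝ¹⁸. -/
def col6 (a b c d e f : V3) : S18 → ℝ :=
  Sum.elim a (Sum.elim b (Sum.elim c (Sum.elim d (Sum.elim e f))))

/-- The 18×3 stacked blocks `(A; B; C; D; E; F)`. -/
def stack6 (A B C D E F : M3) : Matrix S18 (Fin 3) ℝ :=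
  Matrix.of (Sum.elim (fun i => A i) (Sum.elim (fun i => B i) (Sum.elim (fun i => C i)
    (Sum.elim (fun i => D i) (Sum.elim (fun i => E i) (fun i => F i))))))

lemma skew_mulVec (v w : V3) : skew v *ᵥ w = crossProduct v w := by
  ext i
  fin_cases i <;> simp [skew, Matrix.mulVec, dotProduct, Fin.sum_univ_three, cross_apply] <;> ring

lemma IsRot.mul_transpose_self {R : M3} (hR : IsRot R) : R * Rᵀ = 1 :=
  mul_eq_one_comm.mp hR.1

lemma row6_mulVec_col6 (A B C D E F : M3) (a b c d e f : V3) :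
    row6 A B C D E F *ᵥ col6 a b c d e f =
      A *ᵥ a + B *ᵥ b + C *ᵥ c + D *ᵥ d + E *ᵥ e + F *ᵥ f := by
  ext i
  simp only [Matrix.mulVec, dotProduct, row6, col6, Matrix.of_apply, Fintype.sum_sum_type,
    Sum.elim_inl, Sum.elim_inr, Pi.add_apply]
  ring

lemma row6_mul_stack6 (A B C D E F A' B' C' D' E' F' : M3) :
    row6 A B C D E F * stack6 A' B' C' D' E' F' =
      A * A' + B * B' + C * C' + D * D' + E * E' + F * F' := by
  ext i j
  simp only [Matrix.mul_apply, row6, stack6, Matrix.of_apply, Fintype.sum_sum_type,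
    Sum.elim_inl, Sum.elim_inr, Matrix.add_apply]
  ring

/-- every block row of the observability matrix of the linearized aided INS
with a point feature annihilates the 4 directions of global yaw and global translation. -/
theorem point_feature_unobservable_directions
    (g Pf P₁ V₁ : V3) (δt : ℝ) (R₁ : M3) (hR₁ : IsRot R₁) (Γ₂ Γ₄ : M3) :
    let Γ₁ : M3 := skew (Pf - P₁ - δt • V₁ + (δt ^ 2 / 2) • g) * R₁
    let M : Matrix (Fin 3) S18 ℝ := row6 Γ₁ Γ₂ ((-δt) • (1 : M3)) Γ₄ (-1) 1
    let N : Matrix S18 (Fin 1 ⊕ Fin 3) ℝ :=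
      Matrix.of fun s => Sum.elim
        (fun _ : Fin 1 =>
          col6 (R₁ᵀ *ᵥ g) 0 (-(skew V₁ *ᵥ g)) 0 (-(skew P₁ *ᵥ g)) (-(skew Pf *ᵥ g)) s)
        (fun j : Fin 3 => stack6 0 0 0 0 1 1 s j)
    M * N = 0 := by
  intro Γ₁ M N
  have yaw : M *ᵥ col6 (R₁ᵀ *ᵥ g) 0 (-(skew V₁ *ᵥ g)) 0 (-(skew P₁ *ᵥ g)) (-(skew Pf *ᵥ g))
      = 0 := by
    have hΓ₁ : Γ₁ *ᵥ (R₁ᵀ *ᵥ g) = skew (Pf - P₁ - δt • V₁ + (δt ^ 2 / 2) • g) *ᵥ g := by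
      rw [Matrix.mulVec_mulVec, Matrix.mul_assoc, hR₁.mul_transpose_self, Matrix.mul_one]
    rw [row6_mulVec_col6, hΓ₁]
    simp only [skew_mulVec, map_add, map_sub, map_smul, LinearMap.add_apply, LinearMap.sub_apply,
      LinearMap.smul_apply, cross_self, Matrix.mulVec_zero, Matrix.smul_mulVec, Matrix.neg_mulVec,
      Matrix.one_mulVec]
    module
  have translation : M * stack6 0 0 0 0 1 1 = 0 := by
    rw [row6_mul_stack6]
    simp
  ext i (j | j)
  · exact congrFun yaw i
  · exact congrFun (congrFun translation i) j
end
end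

section
/- Let n_L, v_L ∈ ℝ³ be nonzero with n_Lᵀv_L = 0; set w₁ = ‖n_L‖, w₂ = ‖v_L‖, n_e = n_L/w₁, v_e = v_L/w₂, η² = 1/(w₁²+w₂²). Let g, P₁, V₁, P_k ∈ ℝ³, δt ∈ ℝ, let R₁ be a rotation matrix, let Γ_{l2}, Γ_{l3} ∈ ℝ³ˣ³ be arbitrary, and let H ∈ ℝ²ˣ³ satisfy H(n_L − ⌊P_k×⌋v_L) = 0. Define Γ_{l1} = (⌊n_L×⌋ − ⌊(⌊P_k×⌋v_L)×⌋ + ⌊v_L×⌋⌊P₁×⌋ + δt⌊v_L×⌋⌊V₁×⌋ − ½δt²⌊v_L×⌋⌊g×⌋ − ⌊v_L×⌋⌊P_k×⌋)R₁, Γ_{l4} = ⌊n_L×⌋ − ⌊P_k×⌋⌊v_L×⌋, Γ_{l5} = −((w₂/w₁)n_L + (w₁/w₂)⌊P_k×⌋v_L), and the 2×19 matrix M = H·[Γ_{l1}, Γ_{l2}, δt⌊v_L×⌋, Γ_{l3}, ⌊v_L×⌋, Γ_{l4}, Γ_{l5}]. Let N_l ∈ ℝ¹⁹ˣ⁵ have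 column 1 = (R₁ᵀg; 0; −⌊V₁×⌋g; 0; −⌊P₁×⌋g; −g; 0); columns 2–4 given by stacked blocks (0₃ₓ₃; 0₃ₓ₃; 0₃ₓ₃; 0₃ₓ₃; [n_e, v_e, n_e×v_e]; (w₂/w₁)v_e·e₁ᵀ; η²w₂²·e₃ᵀ); and column 5 = (0; 0; v_e; 0; 0; 0; 0). Then M·N_l = 0. Hence the linearized aided INS with a single line feature has at least 5 unobservable directions: rotation about gravity, global translation, and motion along the line direction. -/
open Matrix

noncomputable section

/-- 19-dimensional state index:
(orientation, gyro bias, velocity, accel bias, position, δθ_L, δφ_L). -/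
abbrev S19 : Type := Fin 3 ⊕ Fin 3 ⊕ Fin 3 ⊕ Fin 3 ⊕ Fin 3 ⊕ Fin 3 ⊕ Fin 1

/-- The 3×19 block row `[A B C D E F w]` (last block a column vector). -/
def row6v (A B C D E F : M3) (w : V3) : Matrix (Fin 3) S19 ℝ :=
  Matrix.of fun i =>
    Sum.elim (fun j => A i j) (Sum.elim (fun j => B i j) (Sum.elim (fun j => C i j)
      (Sum.elim (fun j => D i j) (Sum.elim (fun j => E i j)
        (Sum.elim (fun j => F i j) (fun _ => w i))))))

/-- The stacked vector `(a; b; c; d; e; f; s)` in ℝ¹⁹. -/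
def col7 (a b c d e f : V3) (s : ℝ) : S19 → ℝ :=
  Sum.elim a (Sum.elim b (Sum.elim c (Sum.elim d (Sum.elim e (Sum.elim f (fun _ => s))))))

/-- The 19×3 stacked blocks `(A; B; C; D; E; F; r)` (last block a row vector). -/
def stack7 (A B C D E F : M3) (r : V3) : Matrix S19 (Fin 3) ℝ :=
  Matrix.of (Sum.elim (fun i => A i) (Sum.elim (fun i => B i) (Sum.elim (fun i => C i)
    (Sum.elim (fun i => D i) (Sum.elim (fun i => E i)
      (Sum.elim (fun i => F i) (fun _ => r)))))))

lemma row6v_mulVec_col7 (A B C D E F : M3) (w a b c d e f : V3) (s : ℝ) :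
    row6v A B C D E F w *ᵥ col7 a b c d e f s =
      A *ᵥ a + B *ᵥ b + C *ᵥ c + D *ᵥ d + E *ᵥ e + F *ᵥ f + s • w := by
  ext i
  simp only [row6v, col7, mulVec, dotProduct, Fintype.sum_sum_type, of_apply, Sum.elim_inl,
    Sum.elim_inr, Pi.add_apply, Pi.smul_apply, smul_eq_mul, Finset.univ_unique,
    Finset.sum_singleton]
  ring

lemma stack7_apply_eq_col7 (A B C D E F : M3) (r : V3) (j : Fin 3) :
    (fun s => stack7 A B C D E F r s j) =
      col7 (A.col j) (B.col j) (C.col j) (D.col j) (E.col j) (F.col j) (r j) := by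
  ext s
  rcases s with s | s | s | s | s | s | s <;> rfl

lemma cols3_col (a b c : V3) (j : Fin 3) : (cols3 a b c).col j = ![a, b, c] j := by
  fin_cases j <;> rfl

lemma norm3_sq (v : V3) : norm3 v ^ 2 = v ⬝ᵥ v :=
  Real.sq_sqrt (by simpa using dotProduct_star_self_nonneg v)

lemma norm3_ne_zero {v : V3} (hv : v ≠ 0) : norm3 v ≠ 0 := fun h =>
  hv (dotProduct_self_eq_zero.1 (by rw [← norm3_sq, h, zero_pow two_ne_zero]))

lemma rotation_about_gravity_mulVec (n v g P V Q : V3) (t : ℝ) {R : M3} (hR : IsRot R)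
    (B D : M3) (w : V3) :
    row6v ((skew n - skew (skew Q *ᵥ v) + skew v * skew P + t • (skew v * skew V)
          - (t ^ 2 / 2) • (skew v * skew g) - skew v * skew Q) * R)
        B (t • skew v) D (skew v) (skew n - skew Q * skew v) w *ᵥ
      col7 (Rᵀ *ᵥ g) 0 (-(skew V *ᵥ g)) 0 (-(skew P *ᵥ g)) (-g) 0 = 0 := by
  have hRg : R *ᵥ Rᵀ *ᵥ g = g := by
    rw [mulVec_mulVec, mul_eq_one_comm.1 hR.1, one_mulVec]
  rw [row6v_mulVec_col7, ← mulVec_mulVec, hRg]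
  simp only [add_mulVec, sub_mulVec, smul_mulVec, ← mulVec_mulVec, skew_mulVec, mulVec_zero,
    mulVec_neg, cross_self, smul_zero, zero_smul]
  rw [leibniz_cross Q v g]
  module

lemma skew_mulVec_smul_self (v : V3) (c : ℝ) : skew v *ᵥ (c • v) = 0 := by
  rw [skew_mulVec, map_smul, cross_self, smul_zero]

lemma translation_along_moment_mulVec (n v Q : V3) {a b : ℝ} (ha : a ≠ 0) (hb : b ≠ 0) :
    skew v *ᵥ (a⁻¹ • n) + (skew n - skew Q * skew v) *ᵥ ((b / a) • (b⁻¹ • v)) = 0 := by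
  have hc : b / a * b⁻¹ = a⁻¹ := by field_simp
  rw [smul_smul, hc, sub_mulVec, ← mulVec_mulVec, skew_mulVec_smul_self, mulVec_zero, sub_zero,
    skew_mulVec, skew_mulVec, map_smul, map_smul, ← smul_add, cross_anticomm', smul_zero]

lemma translation_normal_mulVec {n v : V3} (Q : V3) (horth : n ⬝ᵥ v = 0) (hn : n ≠ 0)
    (hv : v ≠ 0) {H : Matrix (Fin 2) (Fin 3) ℝ} (hH : H *ᵥ (n - skew Q *ᵥ v) = 0) :
    H *ᵥ (skew v *ᵥ (skew ((norm3 n)⁻¹ • n) *ᵥ ((norm3 v)⁻¹ • v)) +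
      ((norm3 n ^ 2 + norm3 v ^ 2)⁻¹ * norm3 v ^ 2) •
        -((norm3 v / norm3 n) • n + (norm3 n / norm3 v) • (skew Q *ᵥ v))) = 0 := by
  have ha := norm3_ne_zero hn
  have hb := norm3_ne_zero hv
  have hab : norm3 n ^ 2 + norm3 v ^ 2 ≠ 0 := by positivity
  have hcross : skew v *ᵥ (skew ((norm3 n)⁻¹ • n) *ᵥ ((norm3 v)⁻¹ • v)) =
      (norm3 v / norm3 n) • n := by
    simp only [skew_mulVec, map_smul, LinearMap.smul_apply]
    have htriple : crossProduct v (crossProduct n v) = (norm3 v ^ 2) • n := by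
      rw [cross_cross_eq_smul_sub_smul', ← norm3_sq, horth, zero_smul, sub_zero]
    rw [htriple, smul_smul, smul_smul]
    congr 1
    field_simp
  rw [mulVec_sub, sub_eq_zero] at hH
  rw [hcross, mulVec_add, mulVec_smul, mulVec_smul, mulVec_neg, mulVec_add, mulVec_smul,
    mulVec_smul, ← hH, ← add_smul, ← neg_smul, smul_smul, ← add_smul]
  convert zero_smul ℝ _
  field_simp
  ring

/-- the linearized aided INS with a single line feature has at least
5 unobservable directions. -/
theorem single_line_unobservable_directions
    (nL vL g P₁ V₁ Pk : V3) (δt : ℝ) (R₁ : M3) (hR₁ : IsRot R₁)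
    (hnL : nL ≠ 0) (hvL : vL ≠ 0) (horth : nL ⬝ᵥ vL = 0)
    (Γl2 Γl3 : M3) (H : Matrix (Fin 2) (Fin 3) ℝ)
    (hH : H *ᵥ (nL - skew Pk *ᵥ vL) = 0) :
    let w₁ : ℝ := norm3 nL
    let w₂ : ℝ := norm3 vL
    let nE : V3 := w₁⁻¹ • nL
    let vE : V3 := w₂⁻¹ • vL
    let ηsq : ℝ := (w₁ ^ 2 + w₂ ^ 2)⁻¹
    let Γl1 : M3 := (skew nL - skew (skew Pk *ᵥ vL) + skew vL * skew P₁
        + δt • (skew vL * skew V₁) - (δt ^ 2 / 2) • (skew vL * skew g)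
        - skew vL * skew Pk) * R₁
    let Γl4 : M3 := skew nL - skew Pk * skew vL
    let Γl5 : V3 := -((w₂ / w₁) • nL + (w₁ / w₂) • (skew Pk *ᵥ vL))
    let M : Matrix (Fin 2) S19 ℝ :=
      H * row6v Γl1 Γl2 (δt • skew vL) Γl3 (skew vL) Γl4 Γl5
    let Nl : Matrix S19 (Fin 1 ⊕ Fin 3 ⊕ Fin 1) ℝ :=
      Matrix.of fun s => Sum.elim
        (fun _ : Fin 1 =>
          col7 (R₁ᵀ *ᵥ g) 0 (-(skew V₁ *ᵥ g)) 0 (-(skew P₁ *ᵥ g)) (-g) 0 s)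
        (Sum.elim
          (fun j : Fin 3 => stack7 0 0 0 0 (cols3 nE vE (skew nE *ᵥ vE))
            ((w₂ / w₁) • vecMulVec vE e1) ((ηsq * w₂ ^ 2) • e3) s j)
          (fun _ : Fin 1 => col7 0 0 vE 0 0 0 0 s))
    M * Nl = 0 := by
  intro w₁ w₂ nE vE ηsq Γl1 Γl4 Γl5 M Nl
  have hw₁ : w₁ ≠ 0 := norm3_ne_zero hnL
  have hw₂ : w₂ ≠ 0 := norm3_ne_zero hvL
  have hvE : skew vL *ᵥ vE = 0 := skew_mulVec_smul_self vL w₂⁻¹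
  refine ext_col fun j => ?_
  change M *ᵥ Nl.col j = 0
  rw [← mulVec_mulVec]
  rcases j with j | j | j
  · change H *ᵥ (_ *ᵥ col7 _ _ _ _ _ _ _) = 0
    rw [rotation_about_gravity_mulVec nL vL g P₁ V₁ Pk δt hR₁, mulVec_zero]
  · change H *ᵥ (_ *ᵥ fun s => stack7 _ _ _ _ _ _ _ s j) = 0
    rw [stack7_apply_eq_col7, row6v_mulVec_col7, cols3_col]
    have hzero : (0 : M3).col j = 0 := rfl
    have hcol : ((w₂ / w₁) • vecMulVec vE e1).col j = e1 j • (w₂ / w₁) • vE := by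
      ext i
      simp [vecMulVec_apply]
      ring
    simp only [hzero, mulVec_zero, zero_add, hcol]
    fin_cases j
    · simpa [e1, e3] using
        congrArg (H *ᵥ ·) (translation_along_moment_mulVec nL vL Pk hw₁ hw₂)
    · simp [e1, e3, hvE]
    · simpa [e1, e3, w₁, w₂, nE, vE, ηsq, Γl5] using translation_normal_mulVec Pk horth hnL hvL hH
  · change H *ᵥ (_ *ᵥ col7 _ _ _ _ _ _ _) = 0
    rw [row6v_mulVec_col7]
    simp [smul_mulVec, hvE]
end
end

section
/- Let f₁, f₂, c₁, c₂ ∈ ℝ and define the line projection matrix K = [[f₂, 0, 0], [0, f₁, 0], [−f₂c₁, −f₁c₂, f₁f₂]]. For P = (P_x, P_y, P_z) ∈ ℝ³ with P_z ≠ 0, let x(P) = (f₁·P_x/P_z + c₁, f₂·P_y/P_z + c₂, 1) be its homogeneous pinhole projection. Then Kᵀ·x(P) = (f₁f₂/P_z)·P. Consequently, for any P₁, P₂ ∈ ℝ³ with nonzero third components, the vector l' = K·(P₁ × P₂) satisfies x(P₁)ᵀ·l' = 0 and x(P₂)ᵀ·l' = 0; i.e., the projections of P₁ and P₂ lie on the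 image line whose homogeneous coefficients are K applied to the line's Plücker moment vector P₁ × P₂. -/
open Matrix

noncomputable section

theorem dotProduct_skew_mulVec_left (v w : V3) : v ⬝ᵥ (skew v *ᵥ w) = 0 := by
  simp [skew, Matrix.mulVec, dotProduct, Fin.sum_univ_three]
  ring

theorem dotProduct_skew_mulVec_right (v w : V3) : w ⬝ᵥ (skew v *ᵥ w) = 0 := by
  simp [skew, Matrix.mulVec, dotProduct, Fin.sum_univ_three]
  ring

/-- the line projection matrix `K` satisfies `Kᵀ·x(P) = (f₁f₂/P_z)·P`,
so the pinhole projections of `P₁`, `P₂` lie on the image line with homogeneous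
coefficients `K·(P₁ × P₂)`. -/
theorem line_projection_matrix_property
    (f₁ f₂ c₁ c₂ : ℝ) :
    let K : M3 := !![f₂, 0, 0; 0, f₁, 0; -(f₂ * c₁), -(f₁ * c₂), f₁ * f₂]
    let x : V3 → V3 := fun P => ![f₁ * P 0 / P 2 + c₁, f₂ * P 1 / P 2 + c₂, 1]
    (∀ P : V3, P 2 ≠ 0 → Kᵀ *ᵥ x P = (f₁ * f₂ / P 2) • P) ∧
    (∀ P₁ P₂ : V3, P₁ 2 ≠ 0 → P₂ 2 ≠ 0 →
      x P₁ ⬝ᵥ (K *ᵥ (skew P₁ *ᵥ P₂)) = 0 ∧ x P₂ ⬝ᵥ (K *ᵥ (skew P₁ *ᵥ P₂)) = 0) := by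
  intro K x
  have hK : ∀ P : V3, P 2 ≠ 0 → Kᵀ *ᵥ x P = (f₁ * f₂ / P 2) • P := by
    intro P hP
    ext i
    fin_cases i <;>
      simp [K, x, Matrix.mulVec, dotProduct, Fin.sum_univ_three] <;> field_simp <;> ring
  have hdot : ∀ P v : V3, P 2 ≠ 0 →
      x P ⬝ᵥ (K *ᵥ v) = (f₁ * f₂ / P 2) * (P ⬝ᵥ v) := by
    intro P v hP
    rw [Matrix.dotProduct_mulVec, ← Matrix.mulVec_transpose, hK P hP, smul_dotProduct, smul_eq_mul]
  refine ⟨hK, fun P₁ P₂ h₁ h₂ => ⟨?_, ?_⟩⟩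
  · rw [hdot _ _ h₁, dotProduct_skew_mulVec_left, mul_zero]
  · rw [hdot _ _ h₂, dotProduct_skew_mulVec_right, mul_zero]
end
end

section
/- Let R be a rotation matrix, let J ∈ ℝ³ˣ³ be invertible, and let p, p_f, v, g ∈ ℝ³. Define the 15×18 block matrix Ω = [[⌊R(p_f − p)×⌋J, 0, 0, 0, −R, R], [0, I₃, 0, 0, 0, 0], [⌊Rv×⌋J, 0, R, 0, 0, 0], [0, 0, 0, I₃, 0, 0], [⌊Rg×⌋J, 0, 0, 0, 0, 0]] and the 18×4 matrix A whose first column is (J⁻¹Rg; 0; −⌊v×⌋g; 0; −⌊p×⌋g; −⌊p_f×⌋g) and whose last three columns are (0; 0; 0; 0; I₃; I₃) (stacked blocks). Then Ω·A = 0. Hence the gradient matrix of the basis functions β = (R(p_f − p), b_g, Rv, b_a, Rg) for the nonlinear aided INS with a point feature has the 4-dimensional null space A, corresponding to rotation about gravity and global translation of the sensor and feature. -/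
open Matrix

noncomputable section

/-- 15-dimensional row index for the basis-function gradient. -/
abbrev R15 : Type := Fin 3 ⊕ Fin 3 ⊕ Fin 3 ⊕ Fin 3 ⊕ Fin 3

/-- Vertical stack of five 3×18 block rows. -/
def rows5 (r1 r2 r3 r4 r5 : Matrix (Fin 3) S18 ℝ) : Matrix R15 S18 ℝ :=
  Matrix.of (Sum.elim (fun i => r1 i) (Sum.elim (fun i => r2 i)
    (Sum.elim (fun i => r3 i) (Sum.elim (fun i => r4 i) (fun i => r5 i)))))

lemma transpose_mulVec_skew (R : M3) (a b : V3) :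
    Rᵀ *ᵥ (skew (R *ᵥ a) *ᵥ (R *ᵥ b)) = R.det • (skew a *ᵥ b) := by
  ext i
  fin_cases i <;>
    simp [skew, Matrix.mulVec, dotProduct, Fin.sum_univ_three, Matrix.det_fin_three] <;> ring

lemma IsRot.skew_mulVec {R : M3} (hR : IsRot R) (a b : V3) :
    skew (R *ᵥ a) *ᵥ (R *ᵥ b) = R *ᵥ (skew a *ᵥ b) := by
  have h := congrArg (R *ᵥ ·) (transpose_mulVec_skew R a b)
  simpa [Matrix.mulVec_mulVec, ← Matrix.mul_assoc, mul_eq_one_comm.mp hR.1, hR.2] using h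

lemma skew_sub (a b : V3) : skew (a - b) = skew a - skew b := by
  ext i j
  fin_cases i <;> fin_cases j <;> simp [skew] <;> ring

lemma skew_mulVec_self (a : V3) : skew a *ᵥ a = 0 := by
  ext i
  fin_cases i <;> simp [skew, Matrix.mulVec, dotProduct, Fin.sum_univ_three] <;> ring

lemma rows5_mulVec_eq_zero {r₁ r₂ r₃ r₄ r₅ : Matrix (Fin 3) S18 ℝ} {x : S18 → ℝ}
    (h₁ : r₁ *ᵥ x = 0) (h₂ : r₂ *ᵥ x = 0) (h₃ : r₃ *ᵥ x = 0) (h₄ : r₄ *ᵥ x = 0)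
    (h₅ : r₅ *ᵥ x = 0) : rows5 r₁ r₂ r₃ r₄ r₅ *ᵥ x = 0 := by
  ext (i | i | i | i | i)
  exacts [congrFun h₁ i, congrFun h₂ i, congrFun h₃ i, congrFun h₄ i, congrFun h₅ i]

lemma rows5_mul_eq_zero {r₁ r₂ r₃ r₄ r₅ : Matrix (Fin 3) S18 ℝ} {X : Matrix S18 (Fin 3) ℝ}
    (h₁ : r₁ * X = 0) (h₂ : r₂ * X = 0) (h₃ : r₃ * X = 0) (h₄ : r₄ * X = 0)
    (h₅ : r₅ * X = 0) : rows5 r₁ r₂ r₃ r₄ r₅ * X = 0 := by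
  ext (i | i | i | i | i) j
  exacts [congrFun₂ h₁ i j, congrFun₂ h₂ i j, congrFun₂ h₃ i j, congrFun₂ h₄ i j,
    congrFun₂ h₅ i j]

/-- the gradient matrix `Ω` of the basis functions of the nonlinear
aided INS with a point feature has the 4-dimensional null space `A` (rotation about
gravity and global translation). -/
theorem basis_function_gradient_null_space
    (R J : M3) (hR : IsRot R) (hJ : IsUnit J.det) (p pf v g : V3) :
    let Ω : Matrix R15 S18 ℝ := rows5
      (row6 (skew (R *ᵥ (pf - p)) * J) 0 0 0 (-R) R)
      (row6 0 1 0 0 0 0)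
      (row6 (skew (R *ᵥ v) * J) 0 R 0 0 0)
      (row6 0 0 0 1 0 0)
      (row6 (skew (R *ᵥ g) * J) 0 0 0 0 0)
    let A : Matrix S18 (Fin 1 ⊕ Fin 3) ℝ :=
      Matrix.of fun s => Sum.elim
        (fun _ : Fin 1 =>
          col6 (J⁻¹ *ᵥ (R *ᵥ g)) 0 (-(skew v *ᵥ g)) 0 (-(skew p *ᵥ g))
            (-(skew pf *ᵥ g)) s)
        (fun j : Fin 3 => stack6 0 0 0 0 1 1 s j)
    Ω * A = 0 := by
  intro Ω A
  have hJJ (M : M3) (x : V3) : (M * J) *ᵥ (J⁻¹ *ᵥ x) = M *ᵥ x := by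
    rw [Matrix.mulVec_mulVec, Matrix.mul_assoc, Matrix.mul_nonsing_inv _ hJ, Matrix.mul_one]
  have hgravity : Ω *ᵥ col6 (J⁻¹ *ᵥ (R *ᵥ g)) 0 (-(skew v *ᵥ g)) 0 (-(skew p *ᵥ g))
      (-(skew pf *ᵥ g)) = 0 := by
    apply rows5_mulVec_eq_zero <;>
      simp only [row6_mulVec_col6, hJJ, hR.skew_mulVec, skew_sub, skew_mulVec_self,
        Matrix.sub_mulVec, Matrix.mulVec_sub, Matrix.mulVec_neg, Matrix.neg_mulVec,
        Matrix.zero_mulVec, Matrix.mulVec_zero] <;> abel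
  have htranslation : Ω * stack6 0 0 0 0 1 1 = 0 := by
    apply rows5_mul_eq_zero <;> simp [row6_mul_stack6]
  ext i (j | j)
  · exact congrFun hgravity i
  · exact congrFun₂ htranslation i j
end
end
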